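/- arXiv:math/0603691 — 2 statements merged into one kernel-verified Lean document; each statement's English description precedes it below -/
import Mathlib

section
/- There exists a T₀ topological space Y such that Y is not a Q-set (some subset of Y is not G_δ), but every subset A ⊆ Y is contained in a minimal G_δ set Q (i.e., a G_δ set Q ⊇ A such that every G_δ set containing A contains Q). -/
theorem stmt16 :
    ∃ (Y : Type) (t : TopologicalSpace Y),
      @T0Space Y t ∧
      (∃ A : Set Y, ¬ @IsGδ Y t A) ∧
      ∀ A : Set Y, ∃ Q : Set Y, @IsGδ Y t Q ∧ A ⊆ Q ∧
        ∀ Q' : Set Y, @IsGδ Y t Q' → A ⊆ Q' → Q ⊆ Q' := by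
  -- Sierpinski space
  refine ⟨Prop, sierpinskiSpace, inferInstance, ⟨{False}, ?_⟩, ?_⟩
  · rintro ⟨T, hT, -, hs⟩
    have h : True ∈ ({False} : Set Prop) := by
      rw [hs]
      intro u hu
      have hF : False ∈ u := by
        have : False ∈ ⋂₀ T := by rw [← hs]; rfl
        exact this u hu
      have hn := (hT u hu).mem_nhds hF
      rw [nhds_false, Filter.mem_top] at hn
      rw [hn]; trivial
    simp at h
  · intro A
    refine ⟨⋂₀ {Q | IsGδ Q ∧ A ⊆ Q}, ?_, ?_, ?_⟩
    · exact IsGδ.sInter (fun s hs => hs.1) (Set.toFinite _).countable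
    · exact Set.subset_sInter fun s hs => hs.2
    · intro Q' h1 h2
      exact Set.sInter_subset_of_mem ⟨h1, h2⟩
end

section
/- Let X = ω₁ with the topology whose open sets are ∅ and the final segments [α, ω₁) for α < ω₁. Then X is uncountable, contains no uncountable subspace in which every subset is relatively G_δ, and yet for every A ⊆ X the set [min(A), ω₁) is the minimal G_δ set containing A. -/
/-- The ordinals below `ω₁`. -/
abbrev Omega1 : Type 1 := {o : Ordinal // o < (Cardinal.aleph 1).ord}

/-- The topology on `ω₁` whose open sets are `∅` and the final segments
`[α, ω₁)` (equivalently, since `ω₁` is well-ordered, the upper sets). -/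
def finalSegTop : TopologicalSpace Omega1 where
  IsOpen U := IsUpperSet U
  isOpen_univ := isUpperSet_univ
  isOpen_inter := fun _ _ h1 h2 => h1.inter h2
  isOpen_sUnion := fun _ hS => isUpperSet_sUnion hS

theorem isUpperSet_of_gdelta (G : Set Omega1) (hG : @IsGδ Omega1 finalSegTop G) :
    IsUpperSet G := by
  obtain ⟨T, hT, -, rfl⟩ := hG
  exact isUpperSet_sInter fun t ht => hT t ht

theorem stmt17 :
    (∀ U : Set Omega1, @IsOpen Omega1 finalSegTop U ↔ U = ∅ ∨ ∃ a : Omega1, U = Set.Ici a) ∧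
    ¬ Countable Omega1 ∧
    (∀ S : Set Omega1,
      (∀ A ⊆ S, ∃ G : Set Omega1, @IsGδ Omega1 finalSegTop G ∧ A = S ∩ G) →
      S.Countable) ∧
    ∀ A : Set Omega1, ∀ m ∈ A, (∀ a ∈ A, m ≤ a) →
      @IsGδ Omega1 finalSegTop (Set.Ici m) ∧ A ⊆ Set.Ici m ∧
      ∀ Q : Set Omega1, @IsGδ Omega1 finalSegTop Q → A ⊆ Q → Set.Ici m ⊆ Q := by
  refine ⟨?_, ?_, ?_, ?_⟩
  · intro U
    constructor
    · intro hU
      have hU' : IsUpperSet U := hU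
      rcases U.eq_empty_or_nonempty with h | h
      · exact Or.inl h
      · right
        have wf : WellFounded ((· < ·) : Omega1 → Omega1 → Prop) := wellFounded_lt
        refine ⟨wf.min U h, Set.Subset.antisymm ?_ ?_⟩
        · intro x hx
          exact not_lt.mp (wf.not_lt_min U hx)
        · intro x hx
          exact hU' hx (wf.min_mem U h)
    · rintro (rfl | ⟨a, rfl⟩)
      · exact isUpperSet_empty
      · exact isUpperSet_Ici a
  · intro hc
    have h1 : Cardinal.mk Omega1 ≤ Cardinal.aleph0 := Cardinal.mk_le_aleph0_iff.mpr hc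
    have h2 : Cardinal.mk Omega1 = Cardinal.lift.{1} ((Cardinal.aleph 1).ord.card) :=
      Cardinal.mk_Iio_ordinal _
    rw [h2, Cardinal.card_ord, Cardinal.lift_le_aleph0] at h1
    exact absurd h1 (not_le.mpr Cardinal.aleph0_lt_aleph_one)
  · intro S hS
    apply Set.Subsingleton.countable
    have key : ∀ x ∈ S, ∀ y ∈ S, x ≤ y → x = y := by
      intro x hx y hy hxy
      obtain ⟨G, hG, hA⟩ := hS {x} (Set.singleton_subset_iff.mpr hx)
      have hxG : x ∈ S ∩ G := hA ▸ Set.mem_singleton x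
      have hyG : y ∈ S ∩ G := ⟨hy, isUpperSet_of_gdelta G hG hxy hxG.2⟩
      rw [← hA] at hyG
      exact (Set.mem_singleton_iff.mp hyG).symm
    intro x hx y hy
    rcases le_total x y with h | h
    · exact key x hx y hy h
    · exact (key y hy x hx h).symm
  · intro A m hm hmin
    refine ⟨?_, fun a ha => hmin a ha, ?_⟩
    · exact @IsOpen.isGδ Omega1 finalSegTop _ (isUpperSet_Ici m)
    · intro Q hQ hAQ x hx
      exact isUpperSet_of_gdelta Q hQ hx (hAQ hm)
end
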